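/- The truncated geometric mechanism is ε-differentially private for sensitivity-1 counts: let ε > 0, n ≥ 1, ρ = e^{−ε}, and let f, f' be integers in {0,...,n} with |f − f'| ≤ 1. Then for every i ∈ {0,...,n}, Pr(TruncGeom(ε,n,f) = i) ≤ e^{ε} · Pr(TruncGeom(ε,n,f') = i). -/

import Mathlib

/-- The probability mass function of the truncated geometric distribution
`TruncGeom(ε, n, f)` on `{0, ..., n}`, with `ρ = exp (-ε)`. -/
noncomputable def truncGeomPMF (ε : ℝ) (n f : ℕ) (i : ℕ) : ℝ :=
  let ρ := Real.exp (-ε)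
  if i = 0 then ρ ^ f / (1 + ρ)
  else if i = n then ρ ^ (n - f) / (1 + ρ)
  else ((1 - ρ) / (1 + ρ)) * ρ ^ (((f : ℤ) - (i : ℤ)).natAbs)

theorem pow_aux (ε : ℝ) (hε : 0 < ε) (a b : ℕ) (h : b ≤ a + 1) :
    Real.exp (-ε) ^ a ≤ Real.exp ε * Real.exp (-ε) ^ b := by
  rw [← Real.exp_nat_mul, ← Real.exp_nat_mul, ← Real.exp_add]
  apply Real.exp_le_exp.mpr
  have h' : (b : ℝ) ≤ a + 1 := by exact_mod_cast h
  nlinarith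

theorem stmt_16 (ε : ℝ) (hε : 0 < ε) (n f f' : ℕ) (hn : 1 ≤ n)
    (hf : f ≤ n) (hf' : f' ≤ n) (hneighbor : |(f : ℤ) - (f' : ℤ)| ≤ 1) :
    ∀ i ≤ n, truncGeomPMF ε n f i ≤ Real.exp ε * truncGeomPMF ε n f' i := by
  intro i hi
  rw [abs_le] at hneighbor
  have h1 : 0 < 1 + Real.exp (-ε) := by positivity
  have h2 : 0 ≤ 1 - Real.exp (-ε) := by
    have : Real.exp (-ε) ≤ 1 := Real.exp_le_one_iff.mpr (by linarith)
    linarith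
  simp only [truncGeomPMF]
  split_ifs
  · rw [← mul_div_assoc]
    exact div_le_div_of_nonneg_right (pow_aux ε hε _ _ (by omega)) h1.le
  · rw [← mul_div_assoc]
    exact div_le_div_of_nonneg_right (pow_aux ε hε _ _ (by omega)) h1.le
  · rw [mul_left_comm]
    exact mul_le_mul_of_nonneg_left (pow_aux ε hε _ _ (by omega)) (div_nonneg h2 h1.le)
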